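/- Let N ⊂ U(Ig) be the subspace spanned by all products x·u and u·x with x ∈ g ⊂ Ig and u ∈ U(Ig). Then the composite of the algebra homomorphism S(g*) → U(Ig) (induced by the abelian subalgebra g* ⊂ Ig) with the quotient map U(Ig) → U(Ig)/N is surjective, and its kernel equals span{x·Π : x ∈ g, Π ∈ S(g*)}, where g acts on S(g*) by the coadjoint action extended as derivations. Hence it induces a linear isomorphism S(g*)_g ≅ g\U(Ig)/g := U(Ig)/N, where S(g*)_g = S(g*)/span{x·Π} is the space of coinvariants. -/

import Mathlib

noncomputable section

variable {K : Type} [Field K] [CharZero K]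
variable {L : Type} [LieRing L] [LieAlgebra K L]

/-- The coadjoint action of `x ∈ g` on `g*`: `(x·φ)(y) = −φ([x,y])`. -/
def coad (x : L) (φ : Module.Dual K L) : Module.Dual K L :=
  -(φ.comp (LieAlgebra.ad K L x))

@[simp] lemma coad_apply (x : L) (φ : Module.Dual K L) (y : L) :
    coad x φ y = -φ ⁅x, y⁆ := rfl

/-- The bracket of the double `Ig = g* ⋊ g`. -/
def doubleBracket (p q : Module.Dual K L × L) : Module.Dual K L × L :=
  (coad p.2 q.1 - coad q.2 p.1, ⁅p.2, q.2⁆)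

/-- The double `Ig = g* ⋊ g` as a Lie ring. -/
instance doubleLieRing : LieRing (Module.Dual K L × L) :=
  { (inferInstance : AddCommGroup (Module.Dual K L × L)) with
    bracket := doubleBracket
    add_lie := by
      rintro ⟨φ1, x1⟩ ⟨φ2, x2⟩ ⟨φ3, x3⟩
      refine Prod.ext ?_ (add_lie x1 x2 x3)
      ext y
      simp [doubleBracket, add_lie]
      abel
    lie_add := by
      rintro ⟨φ1, x1⟩ ⟨φ2, x2⟩ ⟨φ3, x3⟩
      refine Prod.ext ?_ (lie_add x1 x2 x3)
      ext y
      simp [doubleBracket, lie_add]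
      abel
    lie_self := by
      rintro ⟨φ, x⟩
      refine Prod.ext ?_ (lie_self x)
      ext y
      simp [doubleBracket]
    leibniz_lie := by
      rintro ⟨φ1, x1⟩ ⟨φ2, x2⟩ ⟨φ3, x3⟩
      refine Prod.ext ?_ (leibniz_lie x1 x2 x3)
      ext y
      simp [doubleBracket, lie_lie]
      abel }

lemma double_lie_def (p q : Module.Dual K L × L) : ⁅p, q⁆ = doubleBracket p q := rfl

/-- The double `Ig = g* ⋊ g` as a Lie algebra. -/
instance doubleLieAlgebra : LieAlgebra K (Module.Dual K L × L) where
  lie_smul t p q := by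
    refine Prod.ext ?_ (lie_smul t p.2 q.2)
    ext y
    simp [double_lie_def, doubleBracket]
    ring


set_option linter.unusedSectionVars false

variable {m : ℕ}

/-- The inclusion `g → Ig`, `x ↦ (0, x)`, as a morphism of Lie algebras. -/
def inclL : L →ₗ⁅K⁆ (Module.Dual K L × L) where
  toFun x := ((0 : Module.Dual K L), x)
  map_add' x y := by simp
  map_smul' t x := by simp
  map_lie' := by
    intro x y
    refine Prod.ext ?_ rfl
    ext z
    simp [double_lie_def, doubleBracket]

attribute [local instance 100] LieRing.ofAssociativeRing

/-- The algebra homomorphism `U(g) → U(Ig)` induced by the inclusion `g ⊂ Ig`. -/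
def inclU : UniversalEnvelopingAlgebra K L →ₐ[K]
    UniversalEnvelopingAlgebra K (Module.Dual K L × L) :=
  UniversalEnvelopingAlgebra.lift K
    ((UniversalEnvelopingAlgebra.ι K).comp (inclL (K := K) (L := L)))

/-- The image in `U(Ig)` of the monomial in `S(g*)` with exponent vector `α` (written in the
dual basis coordinates), under the algebra homomorphism `S(g*) → U(Ig)` induced by the abelian
Lie subalgebra `g* ⊂ Ig`. -/
def dualMonomialU (b : Module.Basis (Fin m) K L) (α : Fin m →₀ ℕ) :
    UniversalEnvelopingAlgebra K (Module.Dual K L × L) :=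
  (((List.finRange m).map fun i =>
    (UniversalEnvelopingAlgebra.ι K ((b.dualBasis i : Module.Dual K L), (0 : L))) ^ (α i))).prod

/-- The algebra homomorphism `S(g*) → U(Ig)` (as a linear map), where `S(g*)` is written as a
polynomial algebra in the dual basis coordinates (`X i` stands for `bᵢ*`). -/
def symDualToU (b : Module.Basis (Fin m) K L) :
    MvPolynomial (Fin m) K →ₗ[K] UniversalEnvelopingAlgebra K (Module.Dual K L × L) :=
  (MvPolynomial.basisMonomials (Fin m) K).constr K (dualMonomialU b)

/-- The bilinear map `S(g*) → U(g) → U(Ig)`, `(Π, u) ↦ Π·u`. -/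
def pbwBil (b : Module.Basis (Fin m) K L) :
    MvPolynomial (Fin m) K →ₗ[K] UniversalEnvelopingAlgebra K L →ₗ[K]
      UniversalEnvelopingAlgebra K (Module.Dual K L × L) :=
  ((LinearMap.mul K (UniversalEnvelopingAlgebra K (Module.Dual K L × L))).comp
    (symDualToU b)).compl₂ (inclU (K := K) (L := L)).toLinearMap

/-- The coadjoint action of `x ∈ g` on `S(g*)`, written in dual basis coordinates
(`X i` stands for `bᵢ*`), extended from `g*` as a derivation. -/
def coadS (b : Module.Basis (Fin m) K L) (x : L) :
    MvPolynomial (Fin m) K →ₗ[K] MvPolynomial (Fin m) K :=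
  (MvPolynomial.mkDerivation K fun i =>
    ∑ j, (-(b.repr ⁅x, b j⁆ i)) • MvPolynomial.X j).toLinearMap

open scoped IsMulCommutative in
/-- A commuting family in a possibly noncommutative algebra is the family of values on the
variables of an algebra homomorphism out of a polynomial ring. -/
lemma MvPolynomial.exists_algHom_of_commute {R A σ : Type*} [CommRing R] [Ring A] [Algebra R A]
    (g : σ → A) (hg : ∀ i j, g i * g j = g j * g i) :
    ∃ F : MvPolynomial σ R →ₐ[R] A, ∀ i, F (MvPolynomial.X i) = g i := by
  have := Algebra.isMulCommutative_adjoin R (s := Set.range g) (by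
    rintro _ ⟨i, rfl⟩ _ ⟨j, rfl⟩
    exact hg i j)
  let v : σ → Algebra.adjoin R (Set.range g) := fun i => ⟨g i, Algebra.subset_adjoin ⟨i, rfl⟩⟩
  refine ⟨(Algebra.adjoin R (Set.range g)).val.comp (MvPolynomial.aeval (R := R) v), fun i => ?_⟩
  simp [v]

/-- A linear subspace of an enveloping algebra that contains `1` and is stable under left
multiplication by the generators is everything. -/
lemma UniversalEnvelopingAlgebra.eq_top_of_mul_mem {R G : Type*} [CommRing R] [LieRing G]
    [LieAlgebra R G] (M : Submodule R (UniversalEnvelopingAlgebra R G)) (h1 : 1 ∈ M)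
    (hM : ∀ (g : G), ∀ u ∈ M, UniversalEnvelopingAlgebra.ι R g * u ∈ M) : M = ⊤ := by
  let S : Subalgebra R (UniversalEnvelopingAlgebra R G) :=
    { carrier := {a | ∀ u ∈ M, a * u ∈ M}
      mul_mem' := fun {a c} ha hc u hu => by
        rw [mul_assoc]
        exact ha _ (hc u hu)
      add_mem' := fun {a c} ha hc u hu => by
        rw [add_mul]
        exact M.add_mem (ha u hu) (hc u hu)
      algebraMap_mem' := fun r u hu => by
        rw [← Algebra.smul_def]
        exact M.smul_mem r hu }
  let f : G →ₗ⁅R⁆ S :=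
    { toFun := fun g => ⟨UniversalEnvelopingAlgebra.ι R g, hM g⟩
      map_add' := fun x y => Subtype.ext (map_add _ x y)
      map_smul' := fun t x => Subtype.ext (map_smul _ t x)
      map_lie' := fun {x y} => Subtype.ext (LieHom.map_lie _ x y) }
  have hid : S.val.comp (UniversalEnvelopingAlgebra.lift R f) = AlgHom.id R _ := by
    apply UniversalEnvelopingAlgebra.hom_ext
    ext x
    change ((UniversalEnvelopingAlgebra.lift R f (UniversalEnvelopingAlgebra.ι R x) : S) :
      UniversalEnvelopingAlgebra R G) = UniversalEnvelopingAlgebra.ι R x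
    rw [UniversalEnvelopingAlgebra.lift_ι_apply]
    rfl
  rw [eq_top_iff]
  intro a _
  have ha : ((UniversalEnvelopingAlgebra.lift R f a : S) : UniversalEnvelopingAlgebra R G) = a :=
    DFunLike.congr_fun hid a
  have := (UniversalEnvelopingAlgebra.lift R f a).2 1 h1
  rwa [ha, mul_one] at this

/-- The embedding of `g*` into `S(g*)` as the linear polynomials. -/
def dualToSym (b : Module.Basis (Fin m) K L) : Module.Dual K L →ₗ[K] MvPolynomial (Fin m) K where
  toFun φ := ∑ j, φ (b j) • MvPolynomial.X j
  map_add' φ ψ := by simp [add_smul, Finset.sum_add_distrib]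
  map_smul' t φ := by simp [mul_smul, Finset.smul_sum]

lemma dualToSym_apply (b : Module.Basis (Fin m) K L) (φ : Module.Dual K L) :
    dualToSym b φ = ∑ j, φ (b j) • MvPolynomial.X j := rfl

lemma dualBasis_apply_eq_repr (b : Module.Basis (Fin m) K L) (i : Fin m) (x : L) :
    (b.dualBasis i : Module.Dual K L) x = b.repr x i := by
  simp

lemma dualToSym_dualBasis (b : Module.Basis (Fin m) K L) (i : Fin m) :
    dualToSym b (b.dualBasis i) = MvPolynomial.X i := by
  simp [dualToSym_apply, Finsupp.single_apply]

lemma coadS_one (b : Module.Basis (Fin m) K L) (x : L) : coadS b x 1 = 0 :=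
  Derivation.map_one_eq_zero _

lemma coadS_mul (b : Module.Basis (Fin m) K L) (x : L) (p q : MvPolynomial (Fin m) K) :
    coadS b x (p * q) = p * coadS b x q + q * coadS b x p :=
  Derivation.leibniz _ p q

lemma coadS_X (b : Module.Basis (Fin m) K L) (x : L) (i : Fin m) :
    coadS b x (MvPolynomial.X i) = dualToSym b (coad x (b.dualBasis i)) := by
  simp only [coadS, dualToSym_apply, coad_apply, dualBasis_apply_eq_repr]
  exact MvPolynomial.mkDerivation_X _ _ _

lemma coad_add_left (x y : L) (φ : Module.Dual K L) :
    coad (x + y) φ = coad x φ + coad y φ := by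
  ext z
  simp [add_comm]

lemma coad_smul_left (t : K) (x : L) (φ : Module.Dual K L) :
    coad (t • x) φ = t • coad x φ := by
  ext z
  simp

lemma coad_add_right (x : L) (φ ψ : Module.Dual K L) :
    coad x (φ + ψ) = coad x φ + coad x ψ := by
  ext z
  simp [add_comm]

lemma coad_smul_right (x : L) (t : K) (φ : Module.Dual K L) :
    coad x (t • φ) = t • coad x φ := by
  ext z
  simp

lemma coad_lie (x y : L) (φ : Module.Dual K L) :
    coad ⁅x, y⁆ φ = coad x (coad y φ) - coad y (coad x φ) := by
  ext z
  simp [lie_lie]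

lemma coadS_dualToSym (b : Module.Basis (Fin m) K L) (x : L) (φ : Module.Dual K L) :
    coadS b x (dualToSym b φ) = dualToSym b (coad x φ) := by
  let C : Module.Dual K L →ₗ[K] Module.Dual K L :=
    { toFun := coad x
      map_add' := coad_add_right x
      map_smul' := fun t φ => coad_smul_right x t φ }
  have h : (coadS b x).comp (dualToSym b) = (dualToSym b).comp C := by
    apply b.dualBasis.ext
    intro i
    rw [LinearMap.comp_apply, dualToSym_dualBasis, coadS_X]
    rfl
  exact LinearMap.congr_fun h φ

/-- The coadjoint action of `x ∈ g` on `S(g*)` as a derivation. -/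
def coadDerivation (b : Module.Basis (Fin m) K L) (x : L) :
    Derivation K (MvPolynomial (Fin m) K) (MvPolynomial (Fin m) K) :=
  MvPolynomial.mkDerivation K fun i => ∑ j, (-(b.repr ⁅x, b j⁆ i)) • MvPolynomial.X j

lemma coadDerivation_apply (b : Module.Basis (Fin m) K L) (x : L) (p : MvPolynomial (Fin m) K) :
    coadDerivation b x p = coadS b x p := rfl

lemma coadS_add (b : Module.Basis (Fin m) K L) (x y : L) (p : MvPolynomial (Fin m) K) :
    coadS b (x + y) p = coadS b x p + coadS b y p := by
  have h : coadDerivation b (x + y) = coadDerivation b x + coadDerivation b y := by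
    apply MvPolynomial.derivation_ext
    intro i
    simp only [Derivation.add_apply, coadDerivation_apply, coadS_X, coad_add_left, map_add]
  exact Derivation.congr_fun h p

lemma coadS_smul (b : Module.Basis (Fin m) K L) (t : K) (x : L) (p : MvPolynomial (Fin m) K) :
    coadS b (t • x) p = t • coadS b x p := by
  have h : coadDerivation b (t • x) = t • coadDerivation b x := by
    apply MvPolynomial.derivation_ext
    intro i
    simp only [Derivation.smul_apply, coadDerivation_apply, coadS_X, coad_smul_left, map_smul]
  exact Derivation.congr_fun h p

lemma coadS_zero (b : Module.Basis (Fin m) K L) (p : MvPolynomial (Fin m) K) :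
    coadS b 0 p = 0 := by
  simpa using coadS_smul b 0 0 p

lemma coadS_lie (b : Module.Basis (Fin m) K L) (x y : L) (p : MvPolynomial (Fin m) K) :
    coadS b ⁅x, y⁆ p = coadS b x (coadS b y p) - coadS b y (coadS b x p) := by
  have h : coadDerivation b ⁅x, y⁆ = ⁅coadDerivation b x, coadDerivation b y⁆ := by
    apply MvPolynomial.derivation_ext
    intro i
    simp only [Derivation.commutator_apply, coadDerivation_apply, coadS_X, coad_lie, map_sub,
      coadS_dualToSym]
  have h' := Derivation.congr_fun h p
  rwa [Derivation.commutator_apply] at h'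

/-- The action of `Ig` on `S(g*)`: `g*` acts by multiplication and `g` by the coadjoint action. -/
def doubleActionS (b : Module.Basis (Fin m) K L) :
    (Module.Dual K L × L) →ₗ⁅K⁆ Module.End K (MvPolynomial (Fin m) K) where
  toFun p := LinearMap.mulLeft K (dualToSym b p.1) + coadS b p.2
  map_add' p q := by
    apply LinearMap.ext
    intro r
    simp only [Prod.fst_add, Prod.snd_add, map_add, LinearMap.add_apply,
      LinearMap.mulLeft_apply, coadS_add, add_mul]
    abel
  map_smul' t p := by
    apply LinearMap.ext
    intro r
    simp [coadS_smul]
  map_lie' := by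
    intro p q
    apply LinearMap.ext
    intro r
    simp only [double_lie_def, doubleBracket, LieRing.of_associative_ring_bracket,
      LinearMap.add_apply, LinearMap.sub_apply, Module.End.mul_apply, LinearMap.mulLeft_apply,
      map_add, map_sub, coadS_lie, coadS_mul, coadS_dualToSym]
    ring

lemma doubleActionS_apply (b : Module.Basis (Fin m) K L) (p : Module.Dual K L × L)
    (r : MvPolynomial (Fin m) K) :
    doubleActionS b p r = dualToSym b p.1 * r + coadS b p.2 r := rfl

lemma ι_dual_mul_comm (φ ψ : Module.Dual K L) :
    UniversalEnvelopingAlgebra.ι K (φ, (0 : L)) * UniversalEnvelopingAlgebra.ι K (ψ, (0 : L)) =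
      UniversalEnvelopingAlgebra.ι K (ψ, (0 : L)) * UniversalEnvelopingAlgebra.ι K (φ, (0 : L)) := by
  rw [← sub_eq_zero, ← LieRing.of_associative_ring_bracket, ← LieHom.map_lie]
  have : ⁅(φ, (0 : L)), (ψ, (0 : L))⁆ = 0 := by
    refine Prod.ext ?_ (lie_self 0)
    ext z
    simp [double_lie_def, doubleBracket]
  rw [this, map_zero]

/-- The map `S(g*) → U(Ig)` is an algebra homomorphism extending the inclusion of `g*`. -/
lemma exists_algHom_eq_symDualToU (b : Module.Basis (Fin m) K L) :
    ∃ F : MvPolynomial (Fin m) K →ₐ[K] UniversalEnvelopingAlgebra K (Module.Dual K L × L),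
      F.toLinearMap = symDualToU b ∧
      ∀ φ, F (dualToSym b φ) = UniversalEnvelopingAlgebra.ι K (φ, (0 : L)) := by
  obtain ⟨F, hF⟩ := MvPolynomial.exists_algHom_of_commute (R := K)
    (fun i => UniversalEnvelopingAlgebra.ι K ((b.dualBasis i : Module.Dual K L), (0 : L)))
    (fun i j => ι_dual_mul_comm _ _)
  refine ⟨F, ?_, fun φ => ?_⟩
  · apply (MvPolynomial.basisMonomials (Fin m) K).ext
    intro α
    rw [symDualToU, Module.Basis.constr_basis, MvPolynomial.coe_basisMonomials]
    beta_reduce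
    rw [AlgHom.toLinearMap_apply, MvPolynomial.monomial_eq, map_one, one_mul,
      Finsupp.prod_fintype _ _ (by simp), ← List.prod_ofFn, map_list_prod, List.map_ofFn,
      dualMonomialU, List.ofFn_eq_map]
    simp [Function.comp_def, hF]
  · have h : F.toLinearMap.comp (dualToSym b) =
        (UniversalEnvelopingAlgebra.ι K : _ →ₗ⁅K⁆ UniversalEnvelopingAlgebra K
          (Module.Dual K L × L)).toLinearMap.comp (LinearMap.inl K (Module.Dual K L) L) := by
      apply b.dualBasis.ext
      intro i
      rw [LinearMap.comp_apply, dualToSym_dualBasis]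
      exact hF i
    exact LinearMap.congr_fun h φ

/-- The commutator with `x ∈ g` in `U(Ig)` restricts to the coadjoint action on `S(g*)`. -/
lemma ι_mul_symDualToU (b : Module.Basis (Fin m) K L) (x : L) (q : MvPolynomial (Fin m) K) :
    UniversalEnvelopingAlgebra.ι K ((0 : Module.Dual K L), x) * symDualToU b q =
      symDualToU b (coadS b x q) +
        symDualToU b q * UniversalEnvelopingAlgebra.ι K ((0 : Module.Dual K L), x) := by
  obtain ⟨F, hF, hφ⟩ := exists_algHom_eq_symDualToU b
  simp only [← hF, AlgHom.toLinearMap_apply]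
  induction q using MvPolynomial.induction_on with
  | C a =>
    have h : coadS b x (MvPolynomial.C a) = 0 := by
      rw [← mul_one (MvPolynomial.C a), ← MvPolynomial.smul_eq_C_mul, map_smul, coadS_one,
        smul_zero]
    rw [h, map_zero, zero_add, ← MvPolynomial.algebraMap_eq, AlgHom.commutes,
      Algebra.commutes]
  | add p q hp hq =>
    simp only [map_add, mul_add, add_mul, hp, hq]
    abel
  | mul_X p i hp =>
    have hc : UniversalEnvelopingAlgebra.ι K ((0 : Module.Dual K L), x) *
        UniversalEnvelopingAlgebra.ι K ((b.dualBasis i : Module.Dual K L), (0 : L)) =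
        UniversalEnvelopingAlgebra.ι K (coad x (b.dualBasis i : Module.Dual K L), (0 : L)) +
        UniversalEnvelopingAlgebra.ι K ((b.dualBasis i : Module.Dual K L), (0 : L)) *
          UniversalEnvelopingAlgebra.ι K ((0 : Module.Dual K L), x) := by
      rw [← sub_eq_iff_eq_add, ← LieRing.of_associative_ring_bracket, ← LieHom.map_lie]
      congr 1
      refine Prod.ext ?_ (lie_zero x)
      ext z
      simp [double_lie_def, doubleBracket]
    rw [coadS_mul, mul_comm (MvPolynomial.X i), coadS_X, map_add, map_mul, map_mul, map_mul,
      ← dualToSym_dualBasis b, hφ, hφ, ← mul_assoc, hp, add_mul, mul_assoc (F p), hc, mul_add,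
      mul_assoc]
    abel

/-- Let `N ⊂ U(Ig)` be spanned by all `x·u` and `u·x` with `x ∈ g ⊂ Ig`, `u ∈ U(Ig)`.  The
composite of `S(g*) → U(Ig)` with the quotient `U(Ig) → U(Ig)/N` is surjective with kernel
`span{x·Π}`, hence induces a linear isomorphism `S(g*)_g ≅ g\U(Ig)/g`. -/
theorem symDual_to_double_coinvariants (b : Module.Basis (Fin m) K L) :
    ∀ N : Submodule K (UniversalEnvelopingAlgebra K (Module.Dual K L × L)),
      N = Submodule.span K {v | ∃ (x : L) (u : UniversalEnvelopingAlgebra K (Module.Dual K L × L)),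
        v = UniversalEnvelopingAlgebra.ι K ((0 : Module.Dual K L), x) * u ∨
        v = u * UniversalEnvelopingAlgebra.ι K ((0 : Module.Dual K L), x)} →
    ∀ W : Submodule K (MvPolynomial (Fin m) K),
      W = Submodule.span K {p | ∃ (x : L) (q : MvPolynomial (Fin m) K), p = coadS b x q} →
    Function.Surjective (N.mkQ.comp (symDualToU b)) ∧
    LinearMap.ker (N.mkQ.comp (symDualToU b)) = W ∧
    ∃ e : (MvPolynomial (Fin m) K ⧸ W) ≃ₗ[K]
        (UniversalEnvelopingAlgebra K (Module.Dual K L × L) ⧸ N),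
      ∀ q : MvPolynomial (Fin m) K,
        e (Submodule.Quotient.mk q) = N.mkQ (symDualToU b q) := by
  rintro N hN W hW
  obtain ⟨F, hF, hφ⟩ := exists_algHom_eq_symDualToU b
  have left_mem (x : L) (u) : UniversalEnvelopingAlgebra.ι K ((0 : Module.Dual K L), x) * u ∈ N :=
    hN ▸ Submodule.subset_span ⟨x, u, Or.inl rfl⟩
  have right_mem (x : L) (u) : u * UniversalEnvelopingAlgebra.ι K ((0 : Module.Dual K L), x) ∈ N :=
    hN ▸ Submodule.subset_span ⟨x, u, Or.inr rfl⟩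
  let R : Submodule K (UniversalEnvelopingAlgebra K (Module.Dual K L × L)) :=
    Submodule.span K {v | ∃ (x : L) (u : UniversalEnvelopingAlgebra K (Module.Dual K L × L)),
      v = u * UniversalEnvelopingAlgebra.ι K ((0 : Module.Dual K L), x)}
  have hR (a u) (hu : u ∈ R) : a * u ∈ R := by
    induction hu using Submodule.span_induction with
    | mem u hu =>
      obtain ⟨x, v, rfl⟩ := hu
      exact Submodule.subset_span ⟨x, a * v, (mul_assoc _ _ _).symm⟩
    | zero => simp
    | add u v _ _ hu hv => rw [mul_add]; exact R.add_mem hu hv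
    | smul t u _ hu => rw [mul_smul_comm]; exact R.smul_mem t hu
  have hRN : R ≤ N := by
    refine Submodule.span_le.2 ?_
    rintro _ ⟨x, u, rfl⟩
    exact right_mem x u
  have htop : LinearMap.range (symDualToU b) ⊔ R = ⊤ := by
    apply UniversalEnvelopingAlgebra.eq_top_of_mul_mem
    · refine Submodule.mem_sup_left ⟨1, ?_⟩
      rw [← hF, AlgHom.toLinearMap_apply, map_one]
    · rintro ⟨φ, x⟩ u hu
      obtain ⟨_, ⟨q, rfl⟩, r, hr, rfl⟩ := Submodule.mem_sup.1 hu
      rw [mul_add]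
      refine Submodule.add_mem _ ?_ (Submodule.mem_sup_right (hR _ _ hr))
      have hsplit : ((φ, x) : Module.Dual K L × L) = (φ, 0) + (0, x) := by simp
      rw [hsplit, map_add, add_mul, ι_mul_symDualToU]
      refine Submodule.add_mem _ (Submodule.mem_sup_left ⟨dualToSym b φ * q, ?_⟩)
        (Submodule.add_mem _ (Submodule.mem_sup_left ⟨_, rfl⟩)
          (Submodule.mem_sup_right (Submodule.subset_span ⟨x, _, rfl⟩)))
      rw [← hF, AlgHom.toLinearMap_apply, map_mul, hφ, AlgHom.toLinearMap_apply]
  have hsurj : Function.Surjective (N.mkQ.comp (symDualToU b)) := by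
    intro v
    obtain ⟨u, rfl⟩ := N.mkQ_surjective v
    obtain ⟨_, ⟨q, rfl⟩, r, hr, rfl⟩ :=
      Submodule.mem_sup.1 (htop ▸ Submodule.mem_top : u ∈ LinearMap.range (symDualToU b) ⊔ R)
    refine ⟨q, ?_⟩
    have hr0 : N.mkQ r = 0 := by simpa using hRN hr
    rw [LinearMap.comp_apply, map_add, hr0, add_zero]
  let A := UniversalEnvelopingAlgebra.lift K (doubleActionS b)
  let T : UniversalEnvelopingAlgebra K (Module.Dual K L × L) →ₗ[K] MvPolynomial (Fin m) K :=
    (LinearMap.applyₗ (1 : MvPolynomial (Fin m) K)).comp A.toLinearMap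
  have hAι (p r) : A (UniversalEnvelopingAlgebra.ι K p) r =
      dualToSym b p.1 * r + coadS b p.2 r := by
    rw [← doubleActionS_apply, UniversalEnvelopingAlgebra.lift_ι_apply]
  have hAF (q r : MvPolynomial (Fin m) K) : A (F q) r = q * r := by
    have h : A.comp F = Algebra.lmul K (MvPolynomial (Fin m) K) := by
      apply MvPolynomial.algHom_ext
      intro i
      apply LinearMap.ext
      intro r
      rw [AlgHom.comp_apply, ← dualToSym_dualBasis b i, hφ, hAι]
      simp [coadS_zero]
    exact LinearMap.congr_fun (DFunLike.congr_fun h q) r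
  have hTN : N ≤ W.comap T := by
    rw [hN]
    refine Submodule.span_le.2 ?_
    rintro _ ⟨x, u, rfl | rfl⟩
    · change A (_ * u) 1 ∈ W
      rw [map_mul, Module.End.mul_apply, hAι, map_zero, zero_mul, zero_add, hW]
      exact Submodule.subset_span ⟨x, _, rfl⟩
    · change A (u * _) 1 ∈ W
      rw [map_mul, Module.End.mul_apply, hAι, map_zero, zero_mul, zero_add, coadS_one, map_zero]
      exact W.zero_mem
  have hker : LinearMap.ker (N.mkQ.comp (symDualToU b)) = W := by
    apply le_antisymm
    · intro q hq
      have hq' : symDualToU b q ∈ N := by simpa using hq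
      have := hTN hq'
      rw [← hF] at this
      change A (F q) 1 ∈ W at this
      rwa [hAF, mul_one] at this
    · conv_lhs => rw [hW]
      refine Submodule.span_le.2 ?_
      rintro _ ⟨x, q, rfl⟩
      have h := eq_sub_of_add_eq (ι_mul_symDualToU b x q).symm
      have hmem : symDualToU b (coadS b x q) ∈ N := by
        rw [h]
        exact N.sub_mem (left_mem x _) (right_mem x _)
      simpa using hmem
  refine ⟨hsurj, hker, (Submodule.quotEquivOfEq _ _ hker.symm).trans
    (LinearMap.quotKerEquivOfSurjective _ hsurj), fun q => rfl⟩

end
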